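/- arXiv:2003.11543 — 5 statements merged into one kernel-verified Lean document; each statement's English description precedes it below -/
import Mathlib

section
/- If a dilation of an affine plane fixes two distinct points, then it is the identity map on the point set. -/
/-- An affine plane: a type `P` of points together with a set of subsets of `P`
(the lines) satisfying the three axioms of affine planes. -/
structure AffinePlane (P : Type*) where
  lines : Set (Set P)
  /-- A1: any two distinct points lie on exactly one line. -/
  a1 : ∀ A B : P, A ≠ B → ∃! ℓ : Set P, ℓ ∈ lines ∧ A ∈ ℓ ∧ B ∈ ℓ
  /-- A2: for a point `A` not on a line `ℓ` there is exactly one line through `A`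
  disjoint from `ℓ`. -/
  a2 : ∀ (A : P) (ℓ : Set P), ℓ ∈ lines → A ∉ ℓ →
    ∃! m : Set P, m ∈ lines ∧ A ∈ m ∧ m ∩ ℓ = ∅
  /-- A3: there are three points not all on one line. -/
  a3 : ∃ A B C : P, ∀ ℓ ∈ lines, ¬(A ∈ ℓ ∧ B ∈ ℓ ∧ C ∈ ℓ)

namespace AffinePlane

variable {P : Type*}

/-- Two lines are parallel if they are equal or disjoint. -/
def Parallel (π : AffinePlane P) (ℓ m : Set P) : Prop :=
  ℓ = m ∨ ℓ ∩ m = ∅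

/-- A collineation is a bijection of the points mapping lines to lines. -/
def IsCollineation (π : AffinePlane P) (f : P ≃ P) : Prop :=
  ∀ ℓ ∈ π.lines, f '' ℓ ∈ π.lines

/-- A dilation is a collineation `f` such that for all distinct points `A`, `B`,
the line through `f A` and `f B` is parallel to the line through `A` and `B`. -/
def IsDilation (π : AffinePlane P) (f : P ≃ P) : Prop :=
  IsCollineation π f ∧
  ∀ A B : P, A ≠ B → ∀ ℓ m : Set P,
    (ℓ ∈ π.lines ∧ f A ∈ ℓ ∧ f B ∈ ℓ) →
    (m ∈ π.lines ∧ A ∈ m ∧ B ∈ m) →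
    Parallel π ℓ m

/-- A translation is a dilation which is the identity or has no fixed point. -/
def IsTranslation (π : AffinePlane P) (f : P ≃ P) : Prop :=
  IsDilation π f ∧ (f = Equiv.refl P ∨ ∀ A : P, f A ≠ A)

/-- A dilation maps every line through a fixed point into itself. -/
theorem IsDilation.apply_mem_of_fixed {π : AffinePlane P} {f : P ≃ P} (hf : IsDilation π f)
    {A C : P} (hA : f A = A) {m : Set P} (hm : m ∈ π.lines) (hAm : A ∈ m) (hCm : C ∈ m) :
    f C ∈ m := by
  rcases eq_or_ne A C with rfl | hAC
  · rwa [hA]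
  obtain ⟨ℓ, ⟨hℓ, hAℓ, hCℓ⟩, -⟩ := π.a1 (f A) (f C) (f.injective.ne hAC)
  rcases hf.2 A C hAC ℓ m ⟨hℓ, hAℓ, hCℓ⟩ ⟨hm, hAm, hCm⟩ with rfl | h
  · exact hCℓ
  · rw [hA] at hAℓ
    exact absurd (Set.mem_inter hAℓ hAm) (by simp [h])

/-- A dilation with two fixed points fixes every point off the line joining them. -/
theorem IsDilation.apply_eq_of_notMem {π : AffinePlane P} {f : P ≃ P} (hf : IsDilation π f)
    {A B C : P} (hAB : A ≠ B) (hA : f A = A) (hB : f B = B) {ℓ : Set P} (hℓ : ℓ ∈ π.lines)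
    (hAℓ : A ∈ ℓ) (hBℓ : B ∈ ℓ) (hC : C ∉ ℓ) : f C = C := by
  obtain ⟨m, ⟨hm, hAm, hCm⟩, -⟩ := π.a1 A C (ne_of_mem_of_not_mem hAℓ hC)
  obtain ⟨n, ⟨hn, hBn, hCn⟩, -⟩ := π.a1 B C (ne_of_mem_of_not_mem hBℓ hC)
  by_contra hne
  obtain rfl : m = n := (π.a1 (f C) C hne).unique
    ⟨hm, hf.apply_mem_of_fixed hA hm hAm hCm, hCm⟩
    ⟨hn, hf.apply_mem_of_fixed hB hn hBn hCn, hCn⟩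
  obtain rfl : m = ℓ := (π.a1 A B hAB).unique ⟨hm, hAm, hBn⟩ ⟨hℓ, hAℓ, hBℓ⟩
  exact hC hCm

/-- Every line misses some point. -/
theorem exists_notMem (π : AffinePlane P) {ℓ : Set P} (hℓ : ℓ ∈ π.lines) : ∃ D, D ∉ ℓ := by
  obtain ⟨X, Y, Z, h⟩ := π.a3
  by_contra! hall
  exact h ℓ hℓ ⟨hall X, hall Y, hall Z⟩

/-- A dilation fixing two distinct points is the identity. -/
theorem dilation_with_two_fixed_points_eq_id (π : AffinePlane P)
    (f : P ≃ P) (hf : IsDilation π f) (A B : P) (hAB : A ≠ B)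
    (hA : f A = A) (hB : f B = B) :
    f = Equiv.refl P := by
  obtain ⟨ℓ, ⟨hℓ, hAℓ, hBℓ⟩, -⟩ := π.a1 A B hAB
  obtain ⟨D, hD⟩ := π.exists_notMem hℓ
  have hfD := hf.apply_eq_of_notMem hAB hA hB hℓ hAℓ hBℓ hD
  have hAD := ne_of_mem_of_not_mem hAℓ hD
  obtain ⟨m, ⟨hm, hAm, hDm⟩, -⟩ := π.a1 A D hAD
  ext C
  rw [Equiv.refl_apply]
  by_cases hC : C ∈ ℓ
  · rcases eq_or_ne A C with rfl | hAC
    · exact hA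
    refine hf.apply_eq_of_notMem hAD hA hfD hm hAm hDm fun hCm => hD ?_
    rwa [(π.a1 A C hAC).unique ⟨hℓ, hAℓ, hC⟩ ⟨hm, hAm, hCm⟩]
  · exact hf.apply_eq_of_notMem hAB hA hB hℓ hAℓ hBℓ hC

end AffinePlane
end

section
/- Let δ be a dilation of an affine plane and A a point with δ(A) ≠ A, and let t be the unique line through A and δ(A) (the trace of A relative to δ). Then for every point Q lying on t, the image δ(Q) also lies on t. -/
namespace AffinePlane

variable {P : Type*}

/-- If `δ` is a dilation and `δ A ≠ A`, then every point of the trace of `A`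
(the line through `A` and `δ A`) is mapped by `δ` into that trace. -/
theorem image_of_point_on_trace_mem_trace (π : AffinePlane P)
    (δ : P ≃ P) (hδ : IsDilation π δ) (A : P) (hA : δ A ≠ A)
    (t : Set P) (ht : t ∈ π.lines) (hAt : A ∈ t) (hδAt : δ A ∈ t) :
    ∀ Q ∈ t, δ Q ∈ t := by
  intro Q hQ
  rcases eq_or_ne A Q with rfl | hAQ
  · exact hδAt
  obtain ⟨ℓ, ⟨hℓ, hδAℓ, hδQℓ⟩, -⟩ := π.a1 (δ A) (δ Q) (δ.injective.ne hAQ)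
  rcases hδ.2 A Q hAQ ℓ t ⟨hℓ, hδAℓ, hδQℓ⟩ ⟨ht, hAt, hQ⟩ with rfl | hdisj
  · exact hδQℓ
  · exact absurd hdisj (Set.Nonempty.ne_empty ⟨δ A, hδAℓ, hδAt⟩)

end AffinePlane
end

section
/- Let σ be a translation of an affine plane with σ ≠ id. Then for any two points A and B, the line through A and σ(A) is parallel to the line through B and σ(B); that is, all traces relative to σ form a set of mutually parallel lines. -/
namespace AffinePlane

variable {P : Type*}

/-- A line through a point and its image under a dilation is mapped into itself. -/
theorem IsDilation.mapsTo_trace {π : AffinePlane P} {σ : P ≃ P} (hσ : IsDilation π σ)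
    {A : P} {ℓ : Set P} (hℓ : ℓ ∈ π.lines) (hA : A ∈ ℓ) (hσA : σ A ∈ ℓ) :
    Set.MapsTo σ ℓ ℓ := by
  intro C hC
  by_cases hAC : A = C
  · exact hAC ▸ hσA
  obtain ⟨k, ⟨hk, hAk, hCk⟩, -⟩ := π.a1 (σ A) (σ C) (σ.injective.ne hAC)
  rcases hσ.2 A C hAC k ℓ ⟨hk, hAk, hCk⟩ ⟨hℓ, hA, hC⟩ with rfl | hdisj
  · exact hCk
  · exact (Set.eq_empty_iff_forall_notMem.mp hdisj _ ⟨hAk, hσA⟩).elim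

/-- For a translation `σ ≠ id`, all traces relative to `σ` are mutually
parallel: for any points `A`, `B`, the line through `A` and `σ A` is parallel
to the line through `B` and `σ B`. -/
theorem traces_of_translation_parallel (π : AffinePlane P)
    (σ : P ≃ P) (hσ : IsTranslation π σ) (hne : σ ≠ Equiv.refl P)
    (A B : P) (ℓ m : Set P)
    (hℓ : ℓ ∈ π.lines) (hAℓ : A ∈ ℓ) (hσAℓ : σ A ∈ ℓ)
    (hm : m ∈ π.lines) (hBm : B ∈ m) (hσBm : σ B ∈ m) :
    Parallel π ℓ m := by
  obtain ⟨hdil, hid | hfix⟩ := hσ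
  · exact absurd hid hne
  rcases Set.eq_empty_or_nonempty (ℓ ∩ m) with hdisj | ⟨C, hCℓ, hCm⟩
  · exact Or.inr hdisj
  · exact Or.inl ((π.a1 C (σ C) (hfix C).symm).unique
      ⟨hℓ, hCℓ, hdil.mapsTo_trace hℓ hAℓ hσAℓ hCℓ⟩
      ⟨hm, hCm, hdil.mapsTo_trace hm hBm hσBm hCm⟩)

end AffinePlane
end

section
/- Let σ₁, σ₂, σ be translations of an affine plane, all different from the identity, such that σ₁ has the same direction as σ and σ₂ has the same direction as σ. If the composite σ₂ ∘ σ₁ is not the identity, then σ₂ ∘ σ₁ has the same direction as σ. -/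
namespace AffinePlane

variable {P : Type*}

/-- Two translations `σ`, `τ` have the same direction: for all points `A`, `B`,
the line through `A` and `σ A` is parallel to the line through `B` and `τ B`. -/
def SameDirection (π : AffinePlane P) (σ τ : P ≃ P) : Prop :=
  ∀ (A B : P) (ℓ m : Set P),
    ℓ ∈ π.lines → A ∈ ℓ → σ A ∈ ℓ →
    m ∈ π.lines → B ∈ m → τ B ∈ m →
    Parallel π ℓ m

theorem Parallel.symm {π : AffinePlane P} {ℓ m : Set P} (h : Parallel π ℓ m) :
    Parallel π m ℓ := by
  rcases h with h | h
  · exact Or.inl h.symm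
  · exact Or.inr (by rwa [Set.inter_comm])

/-- Two lines through a common point that are parallel to the same line are equal. -/
theorem eq_of_parallel (π : AffinePlane P) {ℓ k m : Set P} {X : P}
    (hℓ : ℓ ∈ π.lines) (hk : k ∈ π.lines) (hm : m ∈ π.lines) (hXℓ : X ∈ ℓ) (hXk : X ∈ k)
    (hℓm : Parallel π ℓ m) (hkm : Parallel π k m) : ℓ = k := by
  by_cases hX : X ∈ m
  · rcases hℓm with rfl | h
    · rcases hkm with rfl | h'
      · rfl
      · exact absurd (show X ∈ k ∩ ℓ from ⟨hXk, hX⟩) (by simp [h'])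
    · exact absurd (show X ∈ ℓ ∩ m from ⟨hXℓ, hX⟩) (by simp [h])
  · have disj : ∀ n, X ∈ n → Parallel π n m → n ∩ m = ∅ := by
      rintro n hn (rfl | h)
      · exact absurd hn hX
      · exact h
    exact (π.a2 X m hm hX).unique ⟨hℓ, hXℓ, disj ℓ hXℓ hℓm⟩ ⟨hk, hXk, disj k hXk hkm⟩

theorem IsTranslation.apply_ne {π : AffinePlane P} {f : P ≃ P} (hf : IsTranslation π f)
    (hne : f ≠ Equiv.refl P) (A : P) : f A ≠ A :=
  hf.2.resolve_left hne A

/-- If `σ` has no fixed point and has the same direction as `τ`, it preserves every line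
parallel to a line joining a point with its image under `τ`. -/
theorem SameDirection.apply_mem {π : AffinePlane P} {σ τ : P ≃ P}
    (hd : SameDirection π σ τ) (hσ : ∀ A, σ A ≠ A) {B X : P} {m n : Set P}
    (hm : m ∈ π.lines) (hB : B ∈ m) (hτB : τ B ∈ m)
    (hn : n ∈ π.lines) (hnm : Parallel π n m) (hX : X ∈ n) : σ X ∈ n := by
  obtain ⟨k, ⟨hk, hXk, hσk⟩, -⟩ := π.a1 X (σ X) (hσ X).symm
  rw [π.eq_of_parallel hn hk hm hX hXk hnm (hd X B k m hk hXk hσk hm hB hτB)]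
  exact hσk

/-- If a composite of two dilations fixes a point `A`, it preserves the lines through `A`. -/
theorem IsDilation.comp_apply_mem {π : AffinePlane P} {f g : P ≃ P}
    (hf : IsDilation π f) (hg : IsDilation π g) {A C : P} (hA : g (f A) = A) {k : Set P}
    (hk : k ∈ π.lines) (hAk : A ∈ k) (hCk : C ∈ k) : g (f C) ∈ k := by
  by_cases hAC : A = C
  · subst hAC
    rwa [hA]
  have hfAC : f A ≠ f C := f.injective.ne hAC
  obtain ⟨j, hj, -⟩ := π.a1 _ _ hfAC
  obtain ⟨i, hi, -⟩ := π.a1 _ _ (g.injective.ne hfAC)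
  have hij := hg.2 _ _ hfAC i j hi hj
  have hjk := hf.2 A C hAC j k hj ⟨hk, hAk, hCk⟩
  have hAi : A ∈ i := by simpa only [hA] using hi.2.1
  rw [π.eq_of_parallel hk hi.1 hj.1 hAk hAi hjk.symm hij]
  exact hi.2.2

/-- If translations `σ₁` and `σ₂` (both `≠ id`) have the same direction as a
translation `σ ≠ id`, and their composite `σ₂ ∘ σ₁` (i.e. `σ₁.trans σ₂`) is
not the identity, then it has the same direction as `σ`. -/
theorem comp_same_direction (π : AffinePlane P)
    (σ₁ σ₂ σ : P ≃ P)
    (h₁ : IsTranslation π σ₁) (h₂ : IsTranslation π σ₂) (h : IsTranslation π σ)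
    (hne₁ : σ₁ ≠ Equiv.refl P) (hne₂ : σ₂ ≠ Equiv.refl P) (hne : σ ≠ Equiv.refl P)
    (hd₁ : SameDirection π σ₁ σ) (hd₂ : SameDirection π σ₂ σ)
    (hc : σ₁.trans σ₂ ≠ Equiv.refl P) :
    SameDirection π (σ₁.trans σ₂) σ := by
  have hf₁ := h₁.apply_ne hne₁
  have hf₂ := h₂.apply_ne hne₂
  intro A B ℓ m hℓ hAℓ hτℓ hm hBm hσm
  have line_through : ∀ X, ∃ n ∈ π.lines, X ∈ n ∧ Parallel π n m := by
    intro X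
    obtain ⟨n, ⟨hn, hXn, hσn⟩, -⟩ := π.a1 X (σ₁ X) (hf₁ X).symm
    exact ⟨n, hn, hXn, hd₁ X B n m hn hXn hσn hm hBm hσm⟩
  have comp_mem : ∀ n ∈ π.lines, Parallel π n m → ∀ X ∈ n, σ₂ (σ₁ X) ∈ n :=
    fun n hn hnm X hX => hd₂.apply_mem hf₂ hm hBm hσm hn hnm
      (hd₁.apply_mem hf₁ hm hBm hσm hn hnm hX)
  obtain ⟨n, hn, hAn, hnm⟩ := line_through A
  by_cases hA : σ₂ (σ₁ A) = A
  · exfalso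
    apply hc
    have fixed_of_not_mem : ∀ C, C ∉ n → σ₂ (σ₁ C) = C := by
      intro C hC
      by_contra hne'
      obtain ⟨n', hn', hCn', hn'm⟩ := line_through C
      obtain ⟨k, ⟨hk, hAk, hCk⟩, -⟩ := π.a1 A C (fun e => hC (e ▸ hAn))
      have hk' := h₁.1.comp_apply_mem h₂.1 hA hk hAk hCk
      have hkn' : k = n' := (π.a1 _ _ hne').unique ⟨hk, hk', hCk⟩
        ⟨hn', comp_mem n' hn' hn'm C hCn', hCn'⟩
      subst hkn'
      exact hC (π.eq_of_parallel hn hk hm hAn hAk hnm hn'm ▸ hCk)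
    obtain ⟨C, hC⟩ : ∃ C, C ∉ n := by
      by_contra! hall
      obtain ⟨X, Y, Z, hXYZ⟩ := π.a3
      exact hXYZ n hn ⟨hall X, hall Y, hall Z⟩
    ext D
    change σ₂ (σ₁ D) = D
    by_cases hD : D ∈ n
    · by_contra hne'
      obtain ⟨k, ⟨hk, hCk, hDk⟩, -⟩ := π.a1 C D (fun e => hC (e ▸ hD))
      have hk' := h₁.1.comp_apply_mem h₂.1 (fixed_of_not_mem C hC) hk hCk hDk
      have hkn : k = n := (π.a1 _ _ hne').unique ⟨hk, hk', hDk⟩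
        ⟨hn, comp_mem n hn hnm D hD, hD⟩
      exact hC (hkn ▸ hCk)
    · exact fixed_of_not_mem D hD
  · have hℓn : ℓ = n := (π.a1 _ _ hA).unique ⟨hℓ, hτℓ, hAℓ⟩ ⟨hn, comp_mem n hn hnm A hAn, hAn⟩
    exact hℓn ▸ hnm

end AffinePlane
end

section
/- The translation group of an affine plane is a normal subgroup of its dilation group: for every dilation δ and every translation σ, the composite δ⁻¹ ∘ σ ∘ δ is a translation. -/
namespace AffinePlane

variable {P : Type*}

theorem Parallel.trans {π : AffinePlane P} {ℓ m k : Set P} (hℓ : ℓ ∈ π.lines)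
    (hm : m ∈ π.lines) (hk : k ∈ π.lines) (h₁ : Parallel π ℓ m) (h₂ : Parallel π m k) :
    Parallel π ℓ k := by
  rcases h₁ with rfl | h₁
  · exact h₂
  rcases h₂ with rfl | h₂
  · exact Or.inr h₁
  by_cases h : ℓ ∩ k = ∅
  · exact Or.inr h
  obtain ⟨A, hAℓ, hAk⟩ := Set.nonempty_iff_ne_empty.2 h
  have hAm : A ∉ m := fun hAm => (h₁ ▸ (⟨hAℓ, hAm⟩ : A ∈ ℓ ∩ m) : A ∈ (∅ : Set P))
  exact Or.inl ((π.a2 A m hm hAm).unique ⟨hℓ, hAℓ, h₁⟩ ⟨hk, hAk, by rwa [Set.inter_comm]⟩)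

theorem exists_notMem_of_mem_lines (π : AffinePlane P) {ℓ : Set P} (hℓ : ℓ ∈ π.lines) :
    ∃ A, A ∉ ℓ := by
  obtain ⟨A, B, C, h⟩ := π.a3
  by_contra! hall
  exact h ℓ hℓ ⟨hall A, hall B, hall C⟩

theorem singleton_notMem_lines (π : AffinePlane P) (B : P) : {B} ∉ π.lines := by
  intro hB
  obtain ⟨A, hA⟩ := π.exists_notMem_of_mem_lines hB
  have hAB : A ≠ B := hA
  obtain ⟨m, ⟨hm, hAm, hBm⟩, -⟩ := π.a1 A B hAB
  obtain ⟨C, hC⟩ := π.exists_notMem_of_mem_lines hm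
  have hAC : A ≠ C := fun h => hC (h ▸ hAm)
  have hCB : C ≠ B := fun h => hC (h ▸ hBm)
  obtain ⟨k, ⟨hk, hAk, hCk⟩, -⟩ := π.a1 A C hAC
  obtain ⟨n, ⟨hn, hCn, hBn⟩, -⟩ := π.a1 C B hCB
  have hBk : B ∉ k := fun h => hC ((π.a1 A B hAB).unique ⟨hk, hAk, h⟩ ⟨hm, hAm, hBm⟩ ▸ hCk)
  have hAn : A ∉ n := fun h => hC ((π.a1 A B hAB).unique ⟨hn, h, hBn⟩ ⟨hm, hAm, hBm⟩ ▸ hCn)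
  obtain ⟨p, ⟨hp, hAp, hpn⟩, -⟩ := π.a2 A n hn hAn
  have hBp : B ∉ p := fun h => Set.eq_empty_iff_forall_notMem.1 hpn B ⟨h, hBn⟩
  have hpk : p = k := (π.a2 A {B} hB hA).unique
    ⟨hp, hAp, Set.inter_singleton_eq_empty.2 hBp⟩
    ⟨hk, hAk, Set.inter_singleton_eq_empty.2 hBk⟩
  exact Set.eq_empty_iff_forall_notMem.1 hpn C ⟨hpk ▸ hCk, hCn⟩

theorem IsCollineation.symm {π : AffinePlane P} {f : P ≃ P} (hf : IsCollineation π f) :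
    IsCollineation π f.symm := by
  intro ℓ hℓ
  rcases ℓ.subsingleton_or_nontrivial with h | ⟨A, hA, B, hB, hAB⟩
  · rcases h.eq_empty_or_singleton with rfl | ⟨B, rfl⟩
    · simpa using hℓ
    · exact absurd hℓ (π.singleton_notMem_lines B)
  · obtain ⟨m, ⟨hm, hAm, hBm⟩, -⟩ := π.a1 _ _ (f.symm.injective.ne hAB)
    have : ℓ = f '' m := (π.a1 A B hAB).unique ⟨hℓ, hA, hB⟩
      ⟨hf m hm, ⟨_, hAm, f.apply_symm_apply A⟩, ⟨_, hBm, f.apply_symm_apply B⟩⟩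
    rwa [this, f.symm_image_image]

theorem IsDilation.symm {π : AffinePlane P} {f : P ≃ P} (hf : IsDilation π f) :
    IsDilation π f.symm :=
  ⟨hf.1.symm, fun A B hAB ℓ m hℓ hm =>
    (hf.2 _ _ (f.symm.injective.ne hAB) m ℓ (by simpa using hm) hℓ).symm⟩

theorem IsDilation.trans {π : AffinePlane P} {f g : P ≃ P} (hf : IsDilation π f)
    (hg : IsDilation π g) : IsDilation π (f.trans g) := by
  refine ⟨fun ℓ hℓ => ?_, fun A B hAB ℓ m hℓ hm => ?_⟩
  · rw [Equiv.coe_trans, Set.image_comp]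
    exact hg.1 _ (hf.1 ℓ hℓ)
  · have hne : f A ≠ f B := f.injective.ne hAB
    obtain ⟨k, hk, -⟩ := π.a1 _ _ hne
    exact (hg.2 _ _ hne ℓ k hℓ hk).trans hℓ.1 hk.1 hm.1 (hf.2 A B hAB k m hk hm)

/-- The translation group is normal in the dilation group: for every dilation
`δ` and translation `σ`, the composite `δ⁻¹ ∘ σ ∘ δ` (apply `δ`, then `σ`,
then `δ⁻¹`) is a translation. -/
theorem conjugate_of_translation_is_translation (π : AffinePlane P)
    (δ σ : P ≃ P) (hδ : IsDilation π δ) (hσ : IsTranslation π σ) :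
    IsTranslation π ((δ.trans σ).trans δ.symm) := by
  refine ⟨(hδ.trans hσ.1).trans hδ.symm, hσ.2.imp ?_ fun h A hA => ?_⟩
  · rintro rfl
    simp
  · exact h (δ A) (δ.symm_apply_eq.1 hA)

end AffinePlane
end
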